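/- arXiv:0805.4739 — 6 statements merged into one kernel-verified Lean document; each statement's English description precedes it below -/
import Mathlib

section
/- The connected comb C is a compact topological space. -/
open Set Filter Topology TopologicalSpace

noncomputable section

/-- The underlying set of the connected comb `C`: the unit square `[0,1] × [0,1]`. -/
def Comb : Type := unitInterval × unitInterval

namespace Comb

/-- `mk x y` is the point `(x, y)` of the comb. -/
def mk (x y : unitInterval) : Comb := (x, y)

/-- The prescribed basic neighbourhoods `U(x,y,n)`:
for `y = 0` it is `(((x − 2⁻ⁿ, x + 2⁻ⁿ) ∩ [0,1]) × [0,1]) \ ({x} × [2⁻ⁿ, 1])`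
(the intersections with `[0,1]` are automatic since coordinates are in `unitInterval`),
and for `y > 0` it is `{x} × ((y − 2⁻ⁿ, y + 2⁻ⁿ) ∩ [0,1])`. -/
def U (p : Comb) (n : ℕ) : Set Comb :=
  if (p.2 : ℝ) = 0 then
    {q : Comb | (q.1 : ℝ) ∈ Set.Ioo ((p.1 : ℝ) - 2 ^ (-(n : ℤ))) ((p.1 : ℝ) + 2 ^ (-(n : ℤ)))} \
      {q : Comb | q.1 = p.1 ∧ (q.2 : ℝ) ∈ Set.Icc ((2 : ℝ) ^ (-(n : ℤ))) 1}
  else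
    {q : Comb | q.1 = p.1 ∧
      (q.2 : ℝ) ∈ Set.Ioo ((p.2 : ℝ) - 2 ^ (-(n : ℤ))) ((p.2 : ℝ) + 2 ^ (-(n : ℤ)))}

/-- The neighbourhood filter at `p` generated by the basic neighbourhoods `U p n`. -/
def nhdsFun (p : Comb) : Filter Comb := ⨅ n : ℕ, 𝓟 (U p n)

/-- The comb topology: the topology determined by the prescribed neighbourhood bases
(a set is open iff it is a neighbourhood, in the sense of the prescribed bases,
of each of its points). -/
instance : TopologicalSpace Comb := TopologicalSpace.mkOfNhds nhdsFun

end Comb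

/-- The topology generated by `nhdsFun` is coarser at each point than `nhdsFun` itself. -/
theorem Comb.nhdsFun_le_nhds (p : Comb) : Comb.nhdsFun p ≤ 𝓝 p :=
  le_nhds_iff.2 fun _ hp hs => hs p hp

/-- Every ultrafilter on the comb is finer than one of the prescribed neighbourhood filters. -/
theorem Comb.exists_ultrafilter_le_nhdsFun (f : Ultrafilter Comb) :
    ∃ p, (f : Filter Comb) ≤ Comb.nhdsFun p := by
  obtain ⟨x, -, hx⟩ := isCompact_univ.ultrafilter_le_nhds
    (f.map fun q : Comb => q.1) (by simp)
  obtain ⟨y, -, hy⟩ := isCompact_univ.ultrafilter_le_nhds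
    (f.map fun q : Comb => q.2) (by simp)
  have tendsto_fst : Tendsto (fun q : Comb => (q.1 : ℝ)) f (𝓝 x) :=
    (continuous_subtype_val.tendsto x).comp hx
  have tendsto_snd : Tendsto (fun q : Comb => (q.2 : ℝ)) f (𝓝 y) :=
    (continuous_subtype_val.tendsto y).comp hy
  have eventually_near {g : Comb → ℝ} {a : ℝ} (hg : Tendsto g f (𝓝 a)) (n : ℕ) :
      ∀ᶠ q in f, g q ∈ Ioo (a - 2 ^ (-(n : ℤ))) (a + 2 ^ (-(n : ℤ))) := by
    have hpos : (0 : ℝ) < 2 ^ (-(n : ℤ)) := by positivity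
    exact hg (Ioo_mem_nhds (by linarith) (by linarith))
  by_cases hf : ∀ᶠ q : Comb in f, q.1 = x
  · refine ⟨mk x y, le_iInf fun n => le_principal_iff.2 ?_⟩
    filter_upwards [hf, eventually_near tendsto_fst n, eventually_near tendsto_snd n]
      with q hq hq₁ hq₂
    unfold U
    split_ifs with hy₀
    · refine ⟨hq₁, fun h => ?_⟩
      have hy₀ : (y : ℝ) = 0 := hy₀
      rw [hy₀, zero_add] at hq₂
      exact hq₂.2.not_ge h.2.1
    · exact ⟨hq, hq₂⟩
  · refine ⟨mk x 0, le_iInf fun n => le_principal_iff.2 ?_⟩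
    filter_upwards [Ultrafilter.eventually_not.2 hf, eventually_near tendsto_fst n] with q hq hq₁
    rw [U, if_pos (show ((mk x 0).2 : ℝ) = 0 from rfl)]
    exact ⟨hq₁, fun h => hq h.1⟩

/-- The connected comb `C` is a compact topological space. -/
theorem comb_compactSpace : CompactSpace Comb := by
  refine ⟨isCompact_iff_ultrafilter_le_nhds.2 fun f _ => ?_⟩
  obtain ⟨p, hp⟩ := Comb.exists_ultrafilter_le_nhdsFun f
  exact ⟨p, mem_univ p, hp.trans (Comb.nhdsFun_le_nhds p)⟩
end
end

section
/- The connected comb C is a connected topological space. -/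
open Set Filter Topology TopologicalSpace

noncomputable section

namespace Comb

lemma U_antitone (p : Comb) : Antitone (U p) := by
  intro m n hmn q hq
  have h : (2 : ℝ) ^ (-(n : ℤ)) ≤ 2 ^ (-(m : ℤ)) :=
    zpow_le_zpow_right₀ one_le_two (by omega)
  unfold U at hq ⊢
  split_ifs at hq ⊢ with hp
  · obtain ⟨⟨h₁, h₂⟩, h₃⟩ := hq
    exact ⟨⟨by linarith, by linarith⟩, fun h₄ => h₃ ⟨h₄.1, h.trans h₄.2.1, h₄.2.2⟩⟩
  · obtain ⟨h₁, h₂, h₃⟩ := hq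
    exact ⟨h₁, by linarith, by linarith⟩

lemma isOpen_iff {s : Set Comb} : IsOpen s ↔ ∀ p ∈ s, ∃ n, U p n ⊆ s := by
  have h (p : Comb) : s ∈ nhdsFun p ↔ ∃ n, U p n ⊆ s := by
    rw [nhdsFun, mem_iInf_of_directed]
    · simp only [mem_principal]
    · exact directed_of_isDirected_le fun _ _ hmn => principal_mono.2 (U_antitone p hmn)
  simp only [← h]
  rfl

/-- A map from the unit interval whose values near `t` lie in every basic neighbourhood of the
value at `t`, up to the prescribed radius, is continuous. -/
lemma continuous_of_dist_lt {f : unitInterval → Comb}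
    (hf : ∀ t u : unitInterval, ∀ n : ℕ, |(u : ℝ) - t| < 2 ^ (-(n : ℤ)) → f u ∈ U (f t) n) :
    Continuous f := by
  refine continuous_def.2 fun s hs => Metric.isOpen_iff.2 fun t ht => ?_
  obtain ⟨n, hn⟩ := isOpen_iff.1 hs (f t) ht
  exact ⟨2 ^ (-(n : ℤ)), by positivity, fun u hu => hn (hf t u n hu)⟩

lemma continuous_mk_right (x : unitInterval) : Continuous (mk x) := by
  refine continuous_of_dist_lt fun t u n h => ?_
  obtain ⟨h₁, h₂⟩ := abs_lt.1 h
  have hr : (0 : ℝ) < 2 ^ (-(n : ℤ)) := by positivity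
  unfold U
  split_ifs with ht
  · replace ht : (t : ℝ) = 0 := ht
    refine ⟨⟨sub_lt_self _ hr, lt_add_of_pos_right _ hr⟩, fun hu => ?_⟩
    have : (2 : ℝ) ^ (-(n : ℤ)) ≤ u := hu.2.1
    linarith
  · exact ⟨rfl, show (t : ℝ) - _ < u by linarith, show (u : ℝ) < t + _ by linarith⟩

lemma continuous_mk_zero : Continuous fun x => mk x 0 := by
  refine continuous_of_dist_lt fun t u n h => ?_
  obtain ⟨h₁, h₂⟩ := abs_lt.1 h
  have hr : (0 : ℝ) < 2 ^ (-(n : ℤ)) := by positivity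
  unfold U
  split_ifs with h₀
  swap
  · exact absurd rfl h₀
  refine ⟨⟨show (t : ℝ) - _ < u by linarith, show (u : ℝ) < t + _ by linarith⟩, fun hu => ?_⟩
  have : (2 : ℝ) ^ (-(n : ℤ)) ≤ 0 := hu.2.1
  linarith

lemma joined_unitInterval (s t : unitInterval) : Joined s t :=
  ((convex_Icc (0 : ℝ) 1).isPathConnected ⟨0, unitInterval.zero_mem⟩).joinedIn s s.2 t t.2
    |>.joined_subtype

lemma joined_mk_zero_zero (p : Comb) : Joined p (mk 0 0) :=
  ((joined_unitInterval p.2 0).map (continuous_mk_right p.1)).trans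
    ((joined_unitInterval p.1 0).map continuous_mk_zero)

instance : PathConnectedSpace Comb where
  nonempty := ⟨mk 0 0⟩
  joined p q := (joined_mk_zero_zero p).trans (joined_mk_zero_zero q).symm

end Comb

/-- The connected comb `C` is a connected topological space. -/
theorem comb_connectedSpace : ConnectedSpace Comb := by
  infer_instance
end
end

section
/- For every x ∈ [0,1] and all a, b with 0 < a < b ≤ 1, the set D_{x,b} is contained in the interior (taken in the product space C×C) of the set D_{x,a}. -/
open Set Filter Topology TopologicalSpace

noncomputable section

namespace Comb

/-- The cross-shaped set `D_{x,a} = ({x} × [a,1] × C) ∪ (C × {x} × [a,1]) ⊆ C × C`. -/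
def Dset (x : unitInterval) (a : ℝ) : Set (Comb × Comb) :=
  {p : Comb × Comb | p.1.1 = x ∧ (p.1.2 : ℝ) ∈ Set.Icc a 1} ∪
  {p : Comb × Comb | p.2.1 = x ∧ (p.2.2 : ℝ) ∈ Set.Icc a 1}

/-- A subset `E` of the unit square is symmetric if `(x,y) ∈ E ↔ (y,x) ∈ E` for all `x, y`. -/
def SymmSet (E : Set (unitInterval × unitInterval)) : Prop :=
  ∀ x y : unitInterval, (x, y) ∈ E ↔ (y, x) ∈ E

/-- The open set `⋃_{(x,y) ∉ E} ({x} × (0,1]) × ({y} × (0,1])` that is removed from `C × C`. -/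
def removedSet (E : Set (unitInterval × unitInterval)) : Set (Comb × Comb) :=
  ⋃ q ∈ Eᶜ, {p : Comb × Comb | p.1.1 = q.1 ∧ (p.1.2 : ℝ) ∈ Set.Ioc 0 1 ∧
    p.2.1 = q.2 ∧ (p.2.2 : ℝ) ∈ Set.Ioc 0 1}

/-- The space `C_E`: the complement in `C × C` of the removed set. -/
def CE (E : Set (unitInterval × unitInterval)) : Set (Comb × Comb) := (removedSet E)ᶜ

/-- `D^E_{x,a} = D_{x,a} ∩ C_E`. -/
def DE (E : Set (unitInterval × unitInterval)) (x : unitInterval) (a : ℝ) :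
    Set (Comb × Comb) := Dset x a ∩ CE E

/-- The base square `S = {(x,0,y,0) : x, y ∈ [0,1]}` of `C × C`. -/
def baseSquare : Set (Comb × Comb) :=
  {p : Comb × Comb | (p.1.2 : ℝ) = 0 ∧ (p.2.2 : ℝ) = 0}

end Comb

/-- The part of a tooth of the comb lying strictly above a nonnegative height is open. -/
theorem Comb.isOpen_tooth_above (x : unitInterval) {a : ℝ} (ha : 0 ≤ a) :
    IsOpen {q : Comb | q.1 = x ∧ a < (q.2 : ℝ)} := by
  rintro p ⟨rfl, hp⟩
  obtain ⟨n, hn⟩ := exists_pow_lt_of_lt_one (sub_pos.2 hp) (by norm_num : (2 : ℝ)⁻¹ < 1)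
  refine mem_iInf_of_mem n (mem_principal.2 ?_)
  intro q hq
  rw [Comb.U, if_neg (ha.trans_lt hp).ne'] at hq
  obtain ⟨hq₁, hq₂, -⟩ := hq
  rw [zpow_neg, zpow_natCast, ← inv_pow] at hq₂
  exact ⟨hq₁, by linarith⟩

/-- For every `x ∈ [0,1]` and all `a, b` with `0 < a < b ≤ 1`,
`D_{x,b}` is contained in the interior (in the product space `C × C`) of `D_{x,a}`. -/
theorem Dset_subset_interior (x : unitInterval) (a b : ℝ)
    (ha : 0 < a) (hab : a < b) (hb : b ≤ 1) :
    Comb.Dset x b ⊆ interior (Comb.Dset x a) := by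
  have hW := Comb.isOpen_tooth_above x ha.le
  rintro p (⟨hx, hp⟩ | ⟨hx, hp⟩)
  · exact mem_interior.2 ⟨_, fun q hq => Or.inl ⟨hq.1, hq.2.le, q.1.2.2.2⟩,
      hW.preimage continuous_fst, hx, hab.trans_le hp.1⟩
  · exact mem_interior.2 ⟨_, fun q hq => Or.inr ⟨hq.1, hq.2.le, q.2.2.2.2⟩,
      hW.preimage continuous_snd, hx, hab.trans_le hp.1⟩
end
end

section
/- Let E ⊆ [0,1]² be symmetric. For all distinct x, y ∈ [0,1] and every a ∈ (0,1], the intersection D^E_{x,a} ∩ D^E_{y,a} is nonempty if and only if (x,y) ∈ E. -/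
open Set Filter Topology TopologicalSpace

noncomputable section

namespace Comb

/-- A pair of points lies in `C_E` iff the pair of their abscissae lies in `E` whenever both
points are off the base. -/
theorem mem_CE {E : Set (unitInterval × unitInterval)} {p : Comb × Comb} :
    p ∈ CE E ↔ (0 < (p.1.2 : ℝ) → 0 < (p.2.2 : ℝ) → (p.1.1, p.2.1) ∈ E) := by
  simp only [CE, removedSet, mem_compl_iff, mem_iUnion, mem_ofPred_eq, not_exists]
  refine ⟨fun h h1 h2 => ?_, ?_⟩
  · by_contra hE
    exact h _ hE ⟨rfl, ⟨h1, p.1.2.2.2⟩, rfl, ⟨h2, p.2.2.2.2⟩⟩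
  · rintro h ⟨u, v⟩ hE ⟨rfl, h1, rfl, h2⟩
    exact hE (h h1.1 h2.1)

end Comb

/-- Let `E ⊆ [0,1]²` be symmetric. For distinct `x, y ∈ [0,1]` and
`a ∈ (0,1]`, `D^E_{x,a} ∩ D^E_{y,a}` is nonempty iff `(x,y) ∈ E`. -/
theorem DE_inter_nonempty_iff (E : Set (unitInterval × unitInterval))
    (hE : Comb.SymmSet E) (x y : unitInterval) (hxy : x ≠ y) (a : ℝ)
    (ha : a ∈ Set.Ioc (0 : ℝ) 1) :
    (Comb.DE E x a ∩ Comb.DE E y a).Nonempty ↔ (x, y) ∈ E := by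
  constructor
  · rintro ⟨p, ⟨hpx, hpE⟩, hpy, -⟩
    rw [Comb.mem_CE] at hpE
    rcases hpx with ⟨h1, h2⟩ | ⟨h1, h2⟩ <;> rcases hpy with ⟨h3, h4⟩ | ⟨h3, h4⟩
    · exact absurd (h1.symm.trans h3) hxy
    · exact h1 ▸ h3 ▸ hpE (ha.1.trans_le h2.1) (ha.1.trans_le h4.1)
    · exact (hE x y).2 (h1 ▸ h3 ▸ hpE (ha.1.trans_le h4.1) (ha.1.trans_le h2.1))
    · exact absurd (h1.symm.trans h3) hxy
  · intro h
    have hmem : (Comb.mk x 1, Comb.mk y 1) ∈ Comb.CE E := Comb.mem_CE.2 fun _ _ => h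
    have h1 : ((1 : unitInterval) : ℝ) ∈ Set.Icc a 1 := ⟨ha.2, le_rfl⟩
    exact ⟨_, ⟨Or.inl ⟨rfl, h1⟩, hmem⟩, Or.inr ⟨rfl, h1⟩, hmem⟩
end
end

section
/- Let E ⊆ [0,1]² be symmetric and let X ⊆ [0,1] be such that E ⊆ X×X. If there exists a continuous surjection g from N* onto C_E, then there exists a map φ : X → P(ℕ) such that for all distinct x, y ∈ X: φ(x) ∩ φ(y) is infinite if and only if (x,y) ∈ E. -/
open Set Filter Topology TopologicalSpace

noncomputable section

/-- `ℕ* = βℕ \ ℕ`: the remainder of the Čech–Stone compactification of the discrete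
space `ℕ`, realized as the space of free ultrafilters on `ℕ`. -/
def NStar : Set (Ultrafilter ℕ) := (Set.range (pure : ℕ → Ultrafilter ℕ))ᶜ

namespace Comb

theorem isOpen_of_exists_U_subset {s : Set Comb} :
    (∀ p ∈ s, ∃ n, U p n ⊆ s) → IsOpen s := by
  intro h p hp
  obtain ⟨n, hn⟩ := h p hp
  exact mem_iInf_of_mem n (mem_principal.2 hn)

theorem exists_zpow_neg_le {r : ℝ} (hr : 0 < r) : ∃ n : ℕ, (2 : ℝ) ^ (-(n : ℤ)) ≤ r := by
  obtain ⟨n, hn⟩ := exists_pow_lt_of_lt_one hr (by norm_num : (1 / 2 : ℝ) < 1)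
  refine ⟨n, ?_⟩
  rw [zpow_neg, zpow_natCast, ← inv_pow]
  simpa using hn.le

/-- The open tooth `{x} × (0,1]` of the comb. -/
def tooth (x : unitInterval) : Set Comb := {q | q.1 = x ∧ 0 < (q.2 : ℝ)}

/-- The tip `{(x,1)}` of the tooth over `x`. -/
def tip (x : unitInterval) : Set Comb := {q | q.1 = x ∧ (q.2 : ℝ) = 1}

theorem tip_subset_tooth (x : unitInterval) : tip x ⊆ tooth x :=
  fun _ hq => ⟨hq.1, hq.2 ▸ one_pos⟩

theorem isOpen_tooth (x : unitInterval) : IsOpen (tooth x) := by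
  refine isOpen_of_exists_U_subset fun p hp => ?_
  obtain ⟨n, hn⟩ := exists_zpow_neg_le hp.2
  refine ⟨n, fun q hq => ?_⟩
  rw [U, if_neg hp.2.ne'] at hq
  exact ⟨hq.1.trans hp.1, by linarith [hq.2.1]⟩

theorem isClosed_tip (x : unitInterval) : IsClosed (tip x) := by
  refine ⟨isOpen_of_exists_U_subset fun p hp => ?_⟩
  by_cases h0 : (p.2 : ℝ) = 0
  · by_cases hx : p.1 = x
    · refine ⟨0, fun q hq hqt => ?_⟩
      rw [U, if_pos h0] at hq
      exact hq.2 ⟨hqt.1.trans hx.symm, by simp [hqt.2]⟩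
    · have hd : 0 < |(x : ℝ) - p.1| :=
        abs_pos.2 fun h => hx (Subtype.ext (sub_eq_zero.1 h).symm)
      obtain ⟨n, hn⟩ := exists_zpow_neg_le hd
      refine ⟨n, fun q hq hqt => ?_⟩
      rw [U, if_pos h0] at hq
      obtain ⟨⟨h1, h2⟩, -⟩ := hq
      rw [hqt.1] at h1 h2
      exact absurd (abs_lt.2 ⟨by linarith, by linarith⟩) hn.not_gt
  · by_cases hx : p.1 = x
    · have hlt : (p.2 : ℝ) < 1 := lt_of_le_of_ne p.2.2.2 fun h => hp ⟨hx, h⟩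
      obtain ⟨n, hn⟩ := exists_zpow_neg_le (sub_pos.2 hlt)
      refine ⟨n, fun q hq hqt => ?_⟩
      rw [U, if_neg h0] at hq
      linarith [hq.2.2, hqt.2]
    · refine ⟨0, fun q hq hqt => ?_⟩
      rw [U, if_neg h0] at hq
      exact hx (hq.1.symm.trans hqt.1)

/-- Points of `C × C` with a coordinate in `s`. -/
def cross (s : Set Comb) : Set (Comb × Comb) := Prod.fst ⁻¹' s ∪ Prod.snd ⁻¹' s

theorem mem_CE_of_mem {E : Set (unitInterval × unitInterval)} {x y : unitInterval}
    (h : (x, y) ∈ E) : (mk x 1, mk y 1) ∈ CE E := by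
  simp only [CE, removedSet, mem_compl_iff, mem_iUnion, not_exists]
  rintro ⟨a, b⟩ hab ⟨h1, -, h2, -⟩
  obtain rfl : x = a := h1
  obtain rfl : y = b := h2
  exact hab h

theorem mem_of_mem_CE {E : Set (unitInterval × unitInterval)} {x y : unitInterval}
    {p : Comb × Comb} (hp : p ∈ CE E) (h1 : p.1 ∈ tooth x) (h2 : p.2 ∈ tooth y) :
    (x, y) ∈ E := by
  by_contra h
  exact hp (mem_biUnion (show (x, y) ∈ Eᶜ from h)
    ⟨h1.1, ⟨h1.2, p.1.2.2.2⟩, h2.1, h2.2, p.2.2.2.2⟩)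

/-- Two crosses over distinct teeth meet inside `C_E` only if the pair belongs to `E`. -/
theorem mem_of_mem_cross_tooth {E : Set (unitInterval × unitInterval)} (hE : SymmSet E)
    {x y : unitInterval} (hxy : x ≠ y) {p : Comb × Comb} (hp : p ∈ CE E)
    (hx : p ∈ cross (tooth x)) (hy : p ∈ cross (tooth y)) : (x, y) ∈ E := by
  rcases hx with hx | hx <;> rcases hy with hy | hy
  · exact absurd (hx.1.symm.trans hy.1) hxy
  · exact mem_of_mem_CE hp hx hy
  · exact (hE x y).2 (mem_of_mem_CE hp hy hx)
  · exact absurd (hx.1.symm.trans hy.1) hxy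

end Comb

theorem mem_NStar_iff {u : Ultrafilter ℕ} : u ∈ NStar ↔ (u : Filter ℕ) ≤ cofinite := by
  rw [NStar, mem_compl_iff, mem_range, not_exists]
  constructor
  · intro h
    rcases u.le_cofinite_or_eq_pure with h' | ⟨n, hn⟩
    · exact h'
    · exact absurd hn.symm (h n)
  · rintro h n rfl
    have : ({n}ᶜ : Set ℕ) ∈ (pure n : Ultrafilter ℕ) := h (finite_singleton n).compl_mem_cofinite
    exact this rfl

theorem infinite_iff_exists_mem_NStar {s : Set ℕ} :
    s.Infinite ↔ ∃ u ∈ NStar, s ∈ u := by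
  constructor
  · intro hs
    have : (cofinite ⊓ 𝓟 s).NeBot := cofinite_inf_principal_neBot_iff.2 hs
    have hle := Ultrafilter.of_le (cofinite ⊓ 𝓟 s)
    exact ⟨Ultrafilter.of _, mem_NStar_iff.2 (hle.trans inf_le_left),
      hle (mem_inf_of_right (mem_principal_self s))⟩
  · rintro ⟨u, hu, hsu⟩ hfin
    exact Ultrafilter.compl_mem_iff_notMem.1 (mem_NStar_iff.1 hu hfin.compl_mem_cofinite) hsu

theorem isClosed_NStar : IsClosed NStar := by
  refine ⟨?_⟩
  rw [NStar, compl_compl]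
  refine isOpen_iff_mem_nhds.2 ?_
  rintro _ ⟨n, rfl⟩
  refine mem_of_superset ((ultrafilter_isOpen_basic {n}).mem_nhds (Ultrafilter.mem_pure.2 (mem_singleton n))) ?_
  intro u hu
  obtain ⟨m, hm, h⟩ := Ultrafilter.eq_pure_of_finite_mem (finite_singleton n) hu
  exact ⟨m, h.symm⟩

/-- A clopen set of ultrafilters is determined by the principal ultrafilters it contains. -/
theorem preimage_pure_mem_iff_of_isClopen {V : Set (Ultrafilter ℕ)} (hV : IsClopen V)
    (u : Ultrafilter ℕ) : (pure ⁻¹' V : Set ℕ) ∈ u ↔ u ∈ V := by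
  have key : Tendsto (pure : ℕ → Ultrafilter ℕ) u (𝓝 u) := Ultrafilter.tendsto_pure_self u
  refine ⟨fun h => ?_, fun h => key (hV.isOpen.mem_nhds h)⟩
  by_contra hu
  exact Ultrafilter.compl_mem_iff_notMem.1 (key (hV.compl.isOpen.mem_nhds hu)) h

/-- Between a closed and an open subset of `ℕ*` lies the trace of a subset of `ℕ`. -/
theorem exists_set_between {F O : Set NStar} (hF : IsClosed F) (hO : IsOpen O) (hFO : F ⊆ O) :
    ∃ A : Set ℕ, (∀ u ∈ F, A ∈ u.1) ∧ ∀ u : NStar, A ∈ u.1 → u ∈ O := by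
  obtain ⟨W, hW, rfl⟩ := isOpen_induced_iff.1 hO
  obtain ⟨V, hV, hFV, hVW⟩ := exists_clopen_of_closed_subset_open
    (isClosed_NStar.isClosedMap_subtype_val F hF) hW (image_subset_iff.2 hFO)
  refine ⟨pure ⁻¹' V, fun u hu => ?_, fun u hu => ?_⟩
  · exact (preimage_pure_mem_iff_of_isClopen hV u.1).2 (hFV (mem_image_of_mem _ hu))
  · exact hVW ((preimage_pure_mem_iff_of_isClopen hV u.1).1 hu)

/-- Let `E ⊆ [0,1]²` be symmetric with `E ⊆ X × X` for `X ⊆ [0,1]`.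
If there is a continuous surjection from `ℕ*` onto `C_E`, then there is a map
`φ : X → 𝒫(ℕ)` such that for all distinct `x, y ∈ X`: `φ x ∩ φ y` is infinite iff
`(x,y) ∈ E`. -/
theorem exists_representation_of_NStar_image
    (E : Set (unitInterval × unitInterval)) (hE : Comb.SymmSet E)
    (X : Set unitInterval) (hEX : E ⊆ X ×ˢ X)
    (h : ∃ g : ↥NStar → ↥(Comb.CE E), Continuous g ∧ Function.Surjective g) :
    ∃ φ : ↥X → Set ℕ, ∀ x y : ↥X, x ≠ y →
      ((φ x ∩ φ y).Infinite ↔ ((x : unitInterval), (y : unitInterval)) ∈ E) := by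
  obtain ⟨g, hg, hsurj⟩ := h
  have hgv : Continuous fun u => (g u : Comb × Comb) := continuous_subtype_val.comp hg
  have hA (x : unitInterval) : ∃ A : Set ℕ,
      (∀ u, (g u : Comb × Comb) ∈ Comb.cross (Comb.tip x) → A ∈ u.1) ∧
      ∀ u : NStar, A ∈ u.1 → (g u : Comb × Comb) ∈ Comb.cross (Comb.tooth x) :=
    exists_set_between
      ((((Comb.isClosed_tip x).preimage continuous_fst).union
        ((Comb.isClosed_tip x).preimage continuous_snd)).preimage hgv)
      ((((Comb.isOpen_tooth x).preimage continuous_fst).union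
        ((Comb.isOpen_tooth x).preimage continuous_snd)).preimage hgv)
      (preimage_mono (union_subset_union (preimage_mono (Comb.tip_subset_tooth x))
        (preimage_mono (Comb.tip_subset_tooth x))))
  choose A hA₁ hA₂ using hA
  refine ⟨fun x => A x, fun x y hxy => infinite_iff_exists_mem_NStar.trans ⟨?_, fun hE' => ?_⟩⟩
  · rintro ⟨u, hu, hmem⟩
    exact Comb.mem_of_mem_cross_tooth hE (Subtype.coe_ne_coe.2 hxy) (g ⟨u, hu⟩).2
      (hA₂ x ⟨u, hu⟩ (mem_of_superset hmem inter_subset_left))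
      (hA₂ y ⟨u, hu⟩ (mem_of_superset hmem inter_subset_right))
  · obtain ⟨u, hu⟩ := hsurj ⟨_, Comb.mem_CE_of_mem hE'⟩
    exact ⟨u.1, u.2, inter_mem (hA₁ x u (by rw [hu]; exact Or.inl ⟨rfl, rfl⟩))
      (hA₁ y u (by rw [hu]; exact Or.inr ⟨rfl, rfl⟩))⟩
end
end

section
/- Let E ⊆ [0,1]² be symmetric and let X ⊆ [0,1] be such that E ⊆ X×X. If there exists a continuous surjection h from H* onto C_E, then for each x ∈ X there exist rationals a_{x,n} < b_{x,n} with b_{x,n} < a_{x,n+1} for all n ∈ ℕ such that, setting O_x = ⋃_{n∈ℕ} (a_{x,n}, b_{x,n}) ⊆ [0,∞), for all distinct x, y ∈ X: O_x ∩ O_y is unbounded in [0,∞) if and only if (x,y) ∈ E. -/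
open Set Filter Topology TopologicalSpace

noncomputable section

open scoped NNReal

/-- `ℍ* = βℍ \ ℍ`: the remainder of the Čech–Stone compactification of the
half-line `ℍ = [0,∞)` (realized as `ℝ≥0`). -/
def HStar : Set (StoneCech ℝ≥0) := (Set.range (stoneCechUnit : ℝ≥0 → StoneCech ℝ≥0))ᶜ

/-- One step of the up-crossing construction: after a point where `f ≤ c`, the next excursion of
`f` above level `d` is captured by a rational interval on which `c < f`. -/
lemma exists_rat_interval_excursion {f : ℝ → ℝ} (hf : Continuous f) {c d : ℝ} (hcd : c < d)
    (hc : ∀ M, ∃ t, M ≤ t ∧ f t ≤ c) (hd : ∀ M, ∃ t, M ≤ t ∧ d ≤ f t) {p : ℝ} (hp : f p ≤ c) :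
    ∃ (a b : ℚ) (q p' : ℝ), p < a ∧ a < q ∧ q < b ∧ b < p' ∧ f p' ≤ c ∧ d ≤ f q ∧
      (∀ t ∈ Ioo (a : ℝ) b, c < f t) ∧ ∀ t ∈ Icc p p', d ≤ f t → t ∈ Ioo (a : ℝ) b := by
  have hlow : IsClosed {t | f t ≤ c} := isClosed_le hf continuous_const
  have hhigh : IsClosed {t | d ≤ f t} := isClosed_le continuous_const hf
  obtain ⟨q, ⟨hpq, hq⟩, hqmin⟩ : ∃ q, IsLeast (Ici p ∩ {t | d ≤ f t}) q :=
    ⟨_, (isClosed_Ici.inter hhigh).isLeast_csInf (hd p) (bddBelow_Ici.mono inter_subset_left)⟩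
  obtain ⟨p', ⟨hqp', hp'⟩, hp'min⟩ : ∃ p', IsLeast (Ici q ∩ {t | f t ≤ c}) p' :=
    ⟨_, (isClosed_Ici.inter hlow).isLeast_csInf (hc q) (bddBelow_Ici.mono inter_subset_left)⟩
  obtain ⟨l, ⟨hlq, hl⟩, hlmax⟩ : ∃ l, IsGreatest (Iic q ∩ {t | f t ≤ c}) l :=
    ⟨_, (isClosed_Iic.inter hlow).isGreatest_csSup ⟨p, hpq, hp⟩
      (bddAbove_Iic.mono inter_subset_left)⟩
  obtain ⟨m, ⟨hmp', hm⟩, hmmax⟩ : ∃ m, IsGreatest (Iic p' ∩ {t | d ≤ f t}) m :=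
    ⟨_, (isClosed_Iic.inter hhigh).isGreatest_csSup ⟨q, hqp', hq⟩
      (bddAbove_Iic.mono inter_subset_left)⟩
  simp only [mem_Iic, mem_Ici, mem_ofPred_eq] at hpq hq hqp' hp' hlq hl hmp' hm
  have hlq' : l < q := hlq.lt_of_ne (by rintro rfl; linarith)
  have hmp'' : m < p' := hmp'.lt_of_ne (by rintro rfl; linarith)
  obtain ⟨a, hla, haq⟩ := exists_rat_btwn hlq'
  obtain ⟨b, hmb, hbp'⟩ := exists_rat_btwn hmp''
  have hpl : p ≤ l := hlmax ⟨hpq, hp⟩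
  have hqm : q ≤ m := hmmax ⟨hqp', hq⟩
  refine ⟨a, b, q, p', hpl.trans_lt hla, haq, hqm.trans_lt hmb, hbp', hp', hq, ?_, ?_⟩
  · rintro t ⟨hat, htb⟩
    by_contra! hft
    rcases le_total t q with htq | hqt
    · have := hlmax ⟨htq, hft⟩
      linarith
    · have := hp'min ⟨hqt, hft⟩
      linarith
  · rintro t ⟨hpt, htp'⟩ hft
    exact ⟨haq.trans_le (hqmin ⟨hpt, hft⟩), (hmmax ⟨htp', hft⟩).trans_lt hmb⟩

/-- If `f ≤ c` happens arbitrarily far out, then there is an increasing sequence of rational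
intervals with gaps whose union contains all points of `{d ≤ f}` far enough out, and whose
nonnegative points all lie in `{c < f}`. -/
lemma exists_rat_intervals_between {f : ℝ → ℝ} (hf : Continuous f) {c d : ℝ} (hcd : c < d)
    (hc : ∀ M, ∃ t, M ≤ t ∧ f t ≤ c) :
    ∃ a b : ℕ → ℚ, (∀ n, a n < b n ∧ b n < a (n + 1)) ∧
      (∀ t n, 0 ≤ t → t ∈ Ioo (a n : ℝ) (b n) → c < f t) ∧
      ∃ M, ∀ t, M ≤ t → d ≤ f t → ∃ n, t ∈ Ioo (a n : ℝ) (b n) := by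
  by_cases hd : ∀ M, ∃ t, M ≤ t ∧ d ≤ f t
  swap
  · push Not at hd
    obtain ⟨M, hM⟩ := hd
    have hlt : ∀ n : ℕ, -(1 / ((n : ℚ) + 1)) < -(1 / (((n + 1 : ℕ) : ℚ) + 1)) := fun n ↦
      neg_lt_neg (one_div_lt_one_div_of_lt (by positivity) (by push_cast; linarith))
    refine ⟨fun n ↦ -(1 / (n + 1)), fun n ↦ (-(1 / (n + 1)) + -(1 / (((n + 1 : ℕ) : ℚ) + 1))) / 2,
      fun n ↦ ⟨?_, ?_⟩, ?_, M, fun t hMt hdt ↦ absurd hdt (hM t hMt).not_ge⟩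
    · linarith [hlt n]
    · linarith [hlt n]
    · rintro t n ht ⟨-, htb⟩
      have hneg : (-(1 / ((n : ℚ) + 1)) + -(1 / (((n + 1 : ℕ) : ℚ) + 1))) / 2 < 0 := by
        have : 0 < 1 / ((n : ℚ) + 1) := by positivity
        have : 0 < 1 / (((n + 1 : ℕ) : ℚ) + 1) := by positivity
        linarith
      have : (((-(1 / ((n : ℚ) + 1)) + -(1 / (((n + 1 : ℕ) : ℚ) + 1))) / 2 : ℚ) : ℝ) < 0 :=
        mod_cast hneg
      linarith
  choose a b q p' hpa haq hqb hbp' hp' hq hlow hhigh using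
    fun p : {p // f p ≤ c} ↦ exists_rat_interval_excursion hf hcd hc hd p.2
  obtain ⟨p₀, -, hp₀⟩ := hc 0
  let s : ℕ → {p // f p ≤ c} := fun n ↦ (fun p ↦ ⟨p' p, hp' p⟩)^[n] ⟨p₀, hp₀⟩
  have hs : ∀ n, (s (n + 1) : ℝ) = p' (s n) := fun n ↦ by
    simp only [s, Function.iterate_succ_apply']
  have hsq : ∀ n, (s n : ℝ) ≤ q (s n) := fun n ↦ ((hpa _).trans (haq _)).le
  have hqs : ∀ n, q (s n) ≤ s (n + 1) := fun n ↦ by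
    rw [hs]
    exact ((hqb _).trans (hbp' _)).le
  have hmono : Monotone fun n ↦ (s n : ℝ) :=
    monotone_nat_of_le_succ fun n ↦ (hsq n).trans (hqs n)
  have htop : Tendsto (fun n ↦ (s n : ℝ)) atTop atTop := by
    refine (tendsto_atTop_of_monotone hmono).resolve_right ?_
    rintro ⟨L, hL⟩
    have hqL : Tendsto (fun n ↦ q (s n)) atTop (𝓝 L) :=
      tendsto_of_tendsto_of_tendsto_of_le_of_le hL ((tendsto_add_atTop_iff_nat 1).2 hL) hsq hqs
    have h₁ : f L ≤ c := le_of_tendsto' ((hf.tendsto L).comp hL) fun n ↦ (s n).2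
    have h₂ : d ≤ f L := ge_of_tendsto' ((hf.tendsto L).comp hqL) fun n ↦ hq (s n)
    linarith
  have hcover : ∀ n t, p₀ ≤ t → t ≤ s n → d ≤ f t → ∃ k, t ∈ Ioo (a (s k) : ℝ) (b (s k)) := by
    intro n
    induction n with
    | zero =>
      intro t h₁ h₂ h₃
      obtain rfl : t = p₀ := le_antisymm h₂ h₁
      linarith
    | succ n ih =>
      intro t h₁ h₂ h₃
      rcases le_total t (s n) with h | h
      · exact ih t h₁ h h₃
      · exact ⟨n, hhigh _ t ⟨h, hs n ▸ h₂⟩ h₃⟩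
  refine ⟨fun n ↦ a (s n), fun n ↦ b (s n), fun n ↦ ⟨?_, ?_⟩, fun t n _ ↦ hlow _ t, p₀, ?_⟩
  · exact mod_cast (haq (s n)).trans (hqb (s n))
  · have h₁ := hbp' (s n)
    have h₂ := hpa (s (n + 1))
    rw [hs n] at h₂
    exact mod_cast h₁.trans h₂
  · intro t hpt hdt
    obtain ⟨n, hn⟩ := (htop.eventually_ge_atTop t).exists
    exact hcover n t hpt hn hdt

/-- A neighbourhood of a point of `ℍ*` has unbounded trace on `ℍ`. -/
lemma exists_le_stoneCechUnit_mem {z : StoneCech ℝ≥0} (hz : z ∈ HStar) {W : Set (StoneCech ℝ≥0)}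
    (hW : W ∈ 𝓝 z) (M : ℝ≥0) : ∃ t, M ≤ t ∧ stoneCechUnit t ∈ W := by
  by_contra! hM
  have hK : IsClosed (stoneCechUnit '' Icc 0 M) :=
    (isCompact_Icc.image continuous_stoneCechUnit).isClosed
  refine hz (image_subset_range _ (Icc 0 M) (hK.closure_subset ?_))
  refine mem_closure_iff_nhds.2 fun V hV ↦ ?_
  obtain ⟨_, ⟨t, rfl⟩, hV', hW'⟩ :=
    Dense.inter_nhds_nonempty denseRange_stoneCechUnit (inter_mem hV hW)
  exact ⟨_, hV', t, ⟨zero_le, le_of_not_ge fun h ↦ hM t h hW'⟩, rfl⟩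

/-- A continuous function on `βℍ` extending the truncation `s ↦ min s (t + 1)`. -/
lemma exists_continuous_extend_min (t : ℝ≥0) : ∃ u : StoneCech ℝ≥0 → ℝ≥0, Continuous u ∧
    ∀ s, u (stoneCechUnit s) = min (t + 1) s := by
  have hproj : Continuous (projIcc 0 (t + 1) zero_le) := continuous_projIcc
  refine ⟨Subtype.val ∘ stoneCechExtend hproj,
    continuous_subtype_val.comp (continuous_stoneCechExtend hproj), fun s ↦ ?_⟩
  simp [stoneCechExtend_stoneCechUnit, coe_projIcc]

/-- `ℍ` is open in `βℍ`. -/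
lemma isClosed_HStar : IsClosed HStar := by
  refine isClosed_of_closure_subset ?_
  rintro z hz ⟨t, rfl⟩
  obtain ⟨u, hu, hut⟩ := exists_continuous_extend_min t
  have hsub : HStar ⊆ {w | t + 1 ≤ u w} := by
    intro w hw
    by_contra hlt
    replace hlt : u w < t + 1 := not_le.1 hlt
    obtain ⟨s, hs, hs'⟩ := exists_le_stoneCechUnit_mem hw
      ((isOpen_lt hu continuous_const).mem_nhds hlt) (t + 1)
    simp [hut, hs] at hs'
  have := closure_minimal hsub (isClosed_le continuous_const hu) hz
  simp [hut] at this

/-- Every closed subset of `βℍ` with unbounded trace on `ℍ` meets `ℍ*`. -/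
lemma exists_mem_HStar_of_unbounded {F : Set (StoneCech ℝ≥0)} (hF : IsClosed F)
    (h : ¬ BddAbove (stoneCechUnit ⁻¹' F)) : ∃ z ∈ HStar, z ∈ F := by
  have hne : (atTop ⊓ 𝓟 (stoneCechUnit ⁻¹' F) : Filter ℝ≥0).NeBot := by
    refine frequently_mem_iff_neBot.1 (frequently_atTop.2 fun M ↦ ?_)
    obtain ⟨t, ht, hMt⟩ := not_bddAbove_iff.1 h M
    exact ⟨t, hMt.le, ht⟩
  obtain ⟨z, -, hz⟩ := isCompact_univ (X := StoneCech ℝ≥0)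
    (f := map stoneCechUnit (atTop ⊓ 𝓟 (stoneCechUnit ⁻¹' F))) (by simp)
  have hmem : ∀ K : Set (StoneCech ℝ≥0), IsClosed K →
      K ∈ map stoneCechUnit (atTop ⊓ 𝓟 (stoneCechUnit ⁻¹' F)) → z ∈ K := fun K hK hKm ↦
    hK.closure_subset (hz.mono (le_principal_iff.2 hKm)).mem_closure
  refine ⟨z, ?_, hmem F hF (mem_inf_of_right (mem_principal_self _))⟩
  rintro ⟨t, rfl⟩
  obtain ⟨u, hu, hut⟩ := exists_continuous_extend_min t
  have := hmem {w | t + 1 ≤ u w} (isClosed_le continuous_const hu)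
    (mem_inf_of_left (by filter_upwards [Ici_mem_atTop (t + 1)] with s hs; simpa [hut] using hs))
  simp [hut] at this

namespace Comb

/-- The height on the tooth at `x`, extended by zero to the comb. -/
def toothHeight (x : unitInterval) (q : Comb) : ℝ :=
  open Classical in if q.1 = x then (q.2 : ℝ) else 0

lemma isOpen_of_forall_U_subset {s : Set Comb} (h : ∀ p ∈ s, ∃ n, U p n ⊆ s) : IsOpen s :=
  fun p hp ↦ (h p hp).elim fun n hn ↦ mem_iInf_of_mem n hn

lemma continuous_toothHeight (x : unitInterval) : Continuous (toothHeight x) := by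
  refine ⟨fun s hs ↦ isOpen_of_forall_U_subset fun p hp ↦ ?_⟩
  obtain ⟨ε, hε, hεs⟩ := Metric.isOpen_iff.1 hs _ hp
  obtain ⟨δ, hδ, hδε, hδx⟩ : ∃ δ : ℝ, 0 < δ ∧ δ ≤ ε ∧ (p.1 ≠ x → δ ≤ |(x : ℝ) - p.1|) := by
    by_cases hx : p.1 = x
    · exact ⟨ε, hε, le_rfl, fun h ↦ absurd hx h⟩
    · have : 0 < |(x : ℝ) - p.1| := abs_pos.2 (sub_ne_zero.2 fun h ↦ hx (Subtype.ext h.symm))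
      exact ⟨min ε |(x : ℝ) - p.1|, lt_min hε this, min_le_left _ _, fun _ ↦ min_le_right _ _⟩
  obtain ⟨n, hn⟩ := exists_pow_lt_of_lt_one hδ (by norm_num : (1 / 2 : ℝ) < 1)
  have hn' : (2 : ℝ) ^ (-(n : ℤ)) < δ := by simpa using hn
  refine ⟨n, fun q hq ↦ hεs ?_⟩
  rw [Metric.mem_ball, Real.dist_eq]
  have hq₀ : 0 ≤ (q.2 : ℝ) := q.2.2.1
  have hq₁ : (q.2 : ℝ) ≤ 1 := q.2.2.2
  unfold U at hq
  split_ifs at hq with hp₀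
  · obtain ⟨⟨h₁, h₂⟩, h₃⟩ := hq
    have hpz : toothHeight x p = 0 := by simp [toothHeight, hp₀]
    rw [hpz, sub_zero]
    unfold toothHeight
    split_ifs with hqx
    · have hpx : p.1 = x := by
        by_contra hpx
        have hlt : |(x : ℝ) - p.1| < 2 ^ (-(n : ℤ)) := by
          rw [← hqx, abs_lt]
          constructor <;> linarith
        linarith [hδx hpx]
      have : (q.2 : ℝ) < 2 ^ (-(n : ℤ)) := by
        by_contra! hle
        exact h₃ ⟨hqx.trans hpx.symm, hle, hq₁⟩
      rw [abs_of_nonneg hq₀]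
      linarith
    · simpa using hε
  · obtain ⟨h₁, h₂, h₃⟩ := hq
    unfold toothHeight
    rw [h₁]
    split_ifs
    · rw [abs_lt]
      constructor <;> linarith
    · simpa using hε

lemma toothHeight_pos_iff {x : unitInterval} {q : Comb} :
    0 < toothHeight x q ↔ q.1 = x ∧ 0 < (q.2 : ℝ) := by
  unfold toothHeight
  split_ifs with h <;> simp [h]

/-- The height of a point of `C × C` over the cross at `x`. -/
def crossHeight (x : unitInterval) (p : Comb × Comb) : ℝ :=
  max (toothHeight x p.1) (toothHeight x p.2)

lemma continuous_crossHeight (x : unitInterval) : Continuous (crossHeight x) :=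
  ((continuous_toothHeight x).comp continuous_fst).max
    ((continuous_toothHeight x).comp continuous_snd)

/-- If `(x, y) ∉ E` then the open crosses at `x` and `y` are disjoint in `C_E`. -/
lemma mem_of_crossHeight_pos {E : Set (unitInterval × unitInterval)} (hE : SymmSet E)
    {x y : unitInterval} (hxy : x ≠ y) {p : Comb × Comb} (hp : p ∈ CE E)
    (hx : 0 < crossHeight x p) (hy : 0 < crossHeight y p) : (x, y) ∈ E := by
  have key : ∀ u v : unitInterval, 0 < toothHeight u p.1 → 0 < toothHeight v p.2 →
      (u, v) ∈ E := by
    intro u v hu hv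
    rw [toothHeight_pos_iff] at hu hv
    by_contra huv
    exact hp (mem_biUnion (x := (u, v)) huv
      ⟨hu.1, ⟨hu.2, p.1.2.2.2⟩, hv.1, ⟨hv.2, p.2.2.2.2⟩⟩)
  have hne : ∀ q : Comb, 0 < toothHeight x q → 0 < toothHeight y q → False := fun q h₁ h₂ ↦
    hxy ((toothHeight_pos_iff.1 h₁).1.symm.trans (toothHeight_pos_iff.1 h₂).1)
  rcases lt_max_iff.1 hx with hx | hx <;> rcases lt_max_iff.1 hy with hy | hy
  · exact (hne _ hx hy).elim
  · exact key x y hx hy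
  · exact (hE x y).2 (key y x hy hx)
  · exact (hne _ hx hy).elim

/-- If `(x, y) ∈ E` then the crosses at `x` and `y` share the top corner over `(x, y)`. -/
lemma exists_crossHeight_eq_one {E : Set (unitInterval × unitInterval)} {x y : unitInterval}
    (hxy : (x, y) ∈ E) : ∃ p ∈ CE E, 1 ≤ crossHeight x p ∧ 1 ≤ crossHeight y p := by
  refine ⟨(mk x 1, mk y 1), ?_, ?_, ?_⟩
  · intro hmem
    obtain ⟨q, hq, h₁, -, h₂, -⟩ := mem_iUnion₂.1 hmem
    have : q = (x, y) := Prod.ext h₁.symm h₂.symm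
    exact hq (this ▸ hxy)
  · exact le_max_of_le_left (by simp [toothHeight, mk])
  · exact le_max_of_le_right (by simp [toothHeight, mk])

/-- Some point of `C_E` lies on no tooth, so every cross has height zero there. -/
lemma exists_crossHeight_eq_zero (E : Set (unitInterval × unitInterval)) :
    ∃ p ∈ CE E, ∀ x, crossHeight x p = 0 := by
  refine ⟨(mk 0 0, mk 0 0), ?_, fun x ↦ ?_⟩
  swap
  · have : toothHeight x (mk 0 0) = 0 := by
      unfold toothHeight
      split_ifs <;> rfl
    simp [crossHeight, this]
  intro hmem
  obtain ⟨q, -, -, h, -⟩ := mem_iUnion₂.1 hmem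
  exact lt_irrefl (0 : ℝ) h.1

end Comb

/-- Let `E ⊆ [0,1]²` be symmetric with `E ⊆ X × X` for `X ⊆ [0,1]`.
If there is a continuous surjection from `ℍ*` onto `C_E`, then for each `x ∈ X` there
are rationals `a x n < b x n` with `b x n < a x (n+1)` such that, with
`O_x = ⋃ n, (a x n, b x n) ⊆ [0,∞)`, for all distinct `x, y ∈ X`: `O_x ∩ O_y` is
unbounded in `[0,∞)` iff `(x,y) ∈ E`. -/
theorem exists_open_representation_of_HStar_image
    (E : Set (unitInterval × unitInterval)) (hE : Comb.SymmSet E)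
    (X : Set unitInterval) (hEX : E ⊆ X ×ˢ X)
    (h : ∃ g : ↥HStar → ↥(Comb.CE E), Continuous g ∧ Function.Surjective g) :
    ∃ a b : ↥X → ℕ → ℚ,
      (∀ x n, a x n < b x n ∧ b x n < a x (n + 1)) ∧
      (∀ x y : ↥X, x ≠ y →
        (¬ BddAbove ((⋃ n, {t : ℝ≥0 | (a x n : ℝ) < (t : ℝ) ∧ (t : ℝ) < (b x n : ℝ)}) ∩
            (⋃ n, {t : ℝ≥0 | (a y n : ℝ) < (t : ℝ) ∧ (t : ℝ) < (b y n : ℝ)})) ↔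
          ((x : unitInterval), (y : unitInterval)) ∈ E)) := by
  obtain ⟨g, hg, hsurj⟩ := h
  have hext : ∀ x : unitInterval, ∃ f : C(StoneCech ℝ≥0, ℝ), ∀ z : HStar,
      f z = Comb.crossHeight x (g z) := fun x ↦ by
    obtain ⟨f, hf⟩ := ContinuousMap.exists_restrict_eq isClosed_HStar
      (⟨fun z ↦ Comb.crossHeight x (g z),
        (Comb.continuous_crossHeight x).comp (continuous_subtype_val.comp hg)⟩ : C(HStar, ℝ))
    exact ⟨f, fun z ↦ DFunLike.congr_fun hf z⟩
  choose f hf using hext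
  have hint : ∀ x, ∃ a b : ℕ → ℚ, (∀ n, a n < b n ∧ b n < a (n + 1)) ∧
      (∀ (t : ℝ≥0) n, (t : ℝ) ∈ Ioo (a n : ℝ) (b n) → 1 / 4 < f x (stoneCechUnit t)) ∧
      ∃ M : ℝ, ∀ t : ℝ≥0, M ≤ t → 3 / 4 ≤ f x (stoneCechUnit t) →
        ∃ n, (t : ℝ) ∈ Ioo (a n : ℝ) (b n) := fun x ↦ by
    obtain ⟨a, b, hab, hlow, M, hM⟩ := exists_rat_intervals_between
      (f := fun t ↦ f x (stoneCechUnit t.toNNReal)) (c := 1 / 4) (d := 3 / 4)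
      ((f x).continuous.comp (continuous_stoneCechUnit.comp continuous_real_toNNReal))
      (by norm_num) (fun M ↦ by
        obtain ⟨p, hp, hp₀⟩ := Comb.exists_crossHeight_eq_zero E
        obtain ⟨z, hz⟩ := hsurj ⟨p, hp⟩
        have hfz : f x z < 1 / 4 := by
          rw [hf, hz, hp₀]
          norm_num
        obtain ⟨t, hMt, ht⟩ := exists_le_stoneCechUnit_mem z.2
          ((isOpen_lt (f x).continuous continuous_const).mem_nhds hfz) M.toNNReal
        exact ⟨t, Real.toNNReal_le_iff_le_coe.1 hMt, by simpa using LT.lt.le (b := (1 / 4 : ℝ)) ht⟩)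
    exact ⟨a, b, hab, fun t n ht ↦ by simpa using hlow t n t.2 ht, M,
      fun t hMt ht ↦ hM t hMt (by simpa using ht)⟩
  choose a b hab hlow M hM using hint
  refine ⟨fun x ↦ a x, fun x ↦ b x, fun x ↦ hab x, fun x y hxy ↦ ⟨fun hunb ↦ ?_, fun hxyE ↦ ?_⟩⟩
  · obtain ⟨z, hz, hzx, hzy⟩ := exists_mem_HStar_of_unbounded
      (F := {w | 1 / 4 ≤ f x w} ∩ {w | 1 / 4 ≤ f y w})
      ((isClosed_le continuous_const (f x).continuous).inter
        (isClosed_le continuous_const (f y).continuous))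
      (fun hbdd ↦ hunb (hbdd.mono fun t ht ↦ by
        obtain ⟨m, hm⟩ := mem_iUnion.1 ht.1
        obtain ⟨n, hn⟩ := mem_iUnion.1 ht.2
        exact ⟨(hlow x t m hm).le, (hlow y t n hn).le⟩))
    rw [mem_ofPred_eq, hf _ ⟨z, hz⟩] at hzx hzy
    exact Comb.mem_of_crossHeight_pos hE (fun h ↦ hxy (Subtype.ext h)) (g ⟨z, hz⟩).2
      (by linarith) (by linarith)
  · rw [not_bddAbove_iff]
    intro N
    obtain ⟨p, hp, hpx, hpy⟩ := Comb.exists_crossHeight_eq_one hxyE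
    obtain ⟨z, hz⟩ := hsurj ⟨p, hp⟩
    have hzx : 3 / 4 < f x z := by
      rw [hf, hz]
      linarith
    have hzy : 3 / 4 < f y z := by
      rw [hf, hz]
      linarith
    obtain ⟨t, hNt, htx, hty⟩ := exists_le_stoneCechUnit_mem z.2
      (inter_mem ((isOpen_lt continuous_const (f x).continuous).mem_nhds hzx)
        ((isOpen_lt continuous_const (f y).continuous).mem_nhds hzy))
      (max (N + 1) (max (M x).toNNReal (M y).toNNReal))
    simp only [max_le_iff, Real.toNNReal_le_iff_le_coe] at hNt
    exact ⟨t, ⟨mem_iUnion.2 (hM x t hNt.2.1 (le_of_lt htx)),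
      mem_iUnion.2 (hM y t hNt.2.2 (le_of_lt hty))⟩, (lt_add_one N).trans_le hNt.1⟩
end
end
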